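/- arXiv:1504.00122 — 3 statements merged into one kernel-verified Lean document; each statement's English description precedes it below -/
import Mathlib

section
/- Fix an integer k ≥ 2 and let β ∈ ℕ with β ≥ k−1. Let P₁, …, P_k be polynomials with P_i ∈ 𝒫_{β+r_i} for 1 ≤ i ≤ k, and set P_{k+1} = 0. Suppose that for every choice of polynomials Q₁, …, Q_{k+1} with Q_i ∈ 𝒫_{β−(k−1)+r_i} one has Σ_{i=1}^{k} ⟨[F,Q]_i, P_i⟩_{r,β+r_i} = 0, where [F,Q]_i = Σⱼ (Fⱼ ∂Q_i/∂xⱼ − Qⱼ ∂F_i/∂xⱼ). Then P₁ = 0, P_k = 0, and for every 2 ≤ j ≤ k−1 and every Q' ∈ 𝒫_{β−(k−1)+r_j} one has ⟨F(Q'), P_j⟩_{r,β+r_j} = 0. -/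
open MvPolynomial

noncomputable section

/-- The weight vector `r`: variable `xᵢ` (1-based `i ≤ k`, 0-based index `i-1`) has weight
`k+1-i`, so on 0-based index `j < k` the weight is `k - j`; `z` is the variable of 0-based
index `k-1` (weight `1`) and `ε` is the variable of 0-based index `k` (weight `2k-1`). -/
def w (k : ℕ) (i : Fin (k + 1)) : ℕ := if (i : ℕ) < k then k - (i : ℕ) else 2 * k - 1

/-- The index of the variable `z = x_k`. -/
def zv (k : ℕ) : Fin (k + 1) := ⟨k - 1, by omega⟩

/-- The index of the variable `ε = x_{k+1}`. -/
def ev (k : ℕ) : Fin (k + 1) := ⟨k, by omega⟩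

/-- Membership in `𝒫_δ`: every monomial of `f` has weighted degree `δ`. -/
def IsQH (k δ : ℕ) (f : MvPolynomial (Fin (k + 1)) ℝ) : Prop :=
  ∀ s ∈ f.support, ∑ i, w k i * s i = δ

/-- `G_k = z^k + Σ_{i=1}^{k-1} x_i z^{i-1}` (0-based: `Σ_{j<k-1} x_j z^j`). -/
def G (k : ℕ) : MvPolynomial (Fin (k + 1)) ℝ :=
  (X (zv k)) ^ k
    + ∑ i : Fin (k + 1), if (i : ℕ) < k - 1 then X i * (X (zv k)) ^ (i : ℕ) else 0

/-- The inner product `⟨f,g⟩_{r,δ} = Σ_{(r,s)=δ} f_s g_s (s!)^r / δ!`. -/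
def ip (k δ : ℕ) (f g : MvPolynomial (Fin (k + 1)) ℝ) : ℝ :=
  ∑ s ∈ f.support ∪ g.support,
    f.coeff s * g.coeff s * ((∏ i, ((s i).factorial : ℝ) ^ w k i) / (δ.factorial : ℝ))

/-- The principal part `F`: `F₁ = ε`, `Fᵢ = 0` for `2 ≤ i ≤ k-1`, `F_k = -G_k`, `F_{k+1} = 0`. -/
def Fv (k : ℕ) : Fin (k + 1) → MvPolynomial (Fin (k + 1)) ℝ :=
  fun i => if (i : ℕ) = 0 then X (ev k) else if i = zv k then -(G k) else 0

/-- Components of the Lie bracket `[F,Q]ᵢ = Σⱼ (Fⱼ ∂Qᵢ/∂xⱼ − Qⱼ ∂Fᵢ/∂xⱼ)`. -/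
def brkt (k : ℕ) (Q : Fin (k + 1) → MvPolynomial (Fin (k + 1)) ℝ) (i : Fin (k + 1)) :
    MvPolynomial (Fin (k + 1)) ℝ :=
  ∑ j, (Fv k j * pderiv j (Q i) - Q j * pderiv j (Fv k i))

lemma ip_zero_left (k δ : ℕ) (g : MvPolynomial (Fin (k + 1)) ℝ) : ip k δ 0 g = 0 := by
  simp [ip]

lemma ip_zero_right (k δ : ℕ) (f : MvPolynomial (Fin (k + 1)) ℝ) : ip k δ f 0 = 0 := by
  simp [ip]

lemma ip_neg_left (k δ : ℕ) (f g : MvPolynomial (Fin (k + 1)) ℝ) :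
    ip k δ (-f) g = -ip k δ f g := by
  simp [ip, support_neg]

lemma eq_zero_of_ip_self_eq_zero (k δ : ℕ) (f : MvPolynomial (Fin (k + 1)) ℝ)
    (h : ip k δ f f = 0) : f = 0 := by
  have hweight : ∀ s : Fin (k + 1) →₀ ℕ,
      0 < (∏ i, ((s i).factorial : ℝ) ^ w k i) / (δ.factorial : ℝ) := fun s => by
    have := fun i => Nat.factorial_pos (s i)
    have := Nat.factorial_pos δ
    have : 0 < ∏ i, ((s i).factorial : ℝ) ^ w k i :=
      Finset.prod_pos fun i _ => by positivity
    positivity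
  unfold ip at h
  rw [Finset.sum_eq_zero_iff_of_nonneg
    fun s _ => mul_nonneg (mul_self_nonneg _) (hweight s).le] at h
  ext s
  by_contra hs
  have := h s (by simpa using hs)
  rcases mul_eq_zero.1 this with h0 | h0
  · exact hs (by simpa using h0)
  · exact (hweight s).ne' h0

lemma isQH_single {k : ℕ} {d : Fin (k + 1) → ℕ} {a : Fin (k + 1)}
    {q : MvPolynomial (Fin (k + 1)) ℝ} (hq : IsQH k (d a) q) (i : Fin (k + 1)) :
    IsQH k (d i) ((Pi.single a q : Fin (k + 1) → MvPolynomial (Fin (k + 1)) ℝ) i) := by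
  obtain rfl | hi := eq_or_ne i a
  · simpa using hq
  · simp [hi, IsQH]

lemma zv_ne_zero {k : ℕ} (hk : 2 ≤ k) : zv k ≠ 0 := by
  simp only [zv, ne_eq, Fin.ext_iff, Fin.val_zero]
  omega

lemma Fv_zero (k : ℕ) : Fv k 0 = X (ev k) := by
  simp [Fv]

lemma Fv_zv {k : ℕ} (hk : 2 ≤ k) : Fv k (zv k) = -G k := by
  have : (zv k : ℕ) ≠ 0 := by simp only [zv]; omega
  simp [Fv, this]

lemma Fv_of_ne {k : ℕ} {i : Fin (k + 1)} (h0 : i ≠ 0) (hz : i ≠ zv k) : Fv k i = 0 := by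
  simp [Fv, h0, hz]

lemma sum_Fv_mul_pderiv {k : ℕ} (hk : 2 ≤ k) (q : MvPolynomial (Fin (k + 1)) ℝ) :
    ∑ j, Fv k j * pderiv j q = X (ev k) * pderiv 0 q - G k * pderiv (zv k) q := by
  rw [Fintype.sum_eq_add 0 (zv k) (zv_ne_zero hk).symm
    fun j hj => by rw [Fv_of_ne hj.1 hj.2, zero_mul], Fv_zero, Fv_zv hk]
  ring

lemma brkt_single_self (k : ℕ) (a : Fin (k + 1)) (q : MvPolynomial (Fin (k + 1)) ℝ) :
    brkt k (Pi.single a q) a = ∑ j, Fv k j * pderiv j q - q * pderiv a (Fv k a) := by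
  simp [brkt, Finset.sum_sub_distrib, Pi.single_apply, ite_mul]

lemma brkt_single_of_ne {k : ℕ} {a i : Fin (k + 1)} (hi : i ≠ a)
    (q : MvPolynomial (Fin (k + 1)) ℝ) :
    brkt k (Pi.single a q) i = -(q * pderiv a (Fv k i)) := by
  simp [brkt, Pi.single_apply, ite_mul, hi]

lemma pderiv_ev_G {k : ℕ} (hk : 2 ≤ k) : pderiv (ev k) (G k) = 0 := by
  have hz : zv k ≠ ev k := by
    simp only [zv, ev, ne_eq, Fin.ext_iff]
    omega
  rw [G, map_add, map_sum, Finset.sum_eq_zero]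
  · simp [pderiv_X_of_ne hz]
  · intro i _
    split_ifs with hi
    · have hie : i ≠ ev k := by
        simp only [ev, ne_eq, Fin.ext_iff]
        omega
      simp [pderiv_X_of_ne hz, pderiv_X_of_ne hie]
    · exact map_zero _

lemma pderiv_zero_G {k : ℕ} (hk : 2 ≤ k) : pderiv 0 (G k) = 1 := by
  have hz := zv_ne_zero hk
  have hk0 : 0 < k - 1 := by omega
  rw [G, map_add, map_sum, Fintype.sum_eq_single 0]
  · simp [pderiv_X_of_ne hz, hk0]
  · intro i hi
    split_ifs
    · simp [pderiv_X_of_ne hz, pderiv_X_of_ne hi]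
    · exact map_zero _

/-- if `P = (P₁,…,P_k,0)` with `Pᵢ ∈ 𝒫_{β+rᵢ}` is orthogonal to `[F,Q]` for all
`Q` with `Qᵢ ∈ 𝒫_{β-(k-1)+rᵢ}`, then `P₁ = 0`, `P_k = 0`, and for each `2 ≤ j ≤ k-1` the
component `P_j` is orthogonal to `F(Q') = ε ∂Q'/∂x₁ − G_k ∂Q'/∂z` for all
`Q' ∈ 𝒫_{β-(k-1)+r_j}`. -/
theorem dstar_kernel_structure (k : ℕ) (hk : 2 ≤ k) (β : ℕ) (hβ : k - 1 ≤ β)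
    (P : Fin (k + 1) → MvPolynomial (Fin (k + 1)) ℝ)
    (hP : ∀ i : Fin (k + 1), (i : ℕ) < k → IsQH k (β + w k i) (P i))
    (hPe : P (ev k) = 0)
    (horth : ∀ Q : Fin (k + 1) → MvPolynomial (Fin (k + 1)) ℝ,
      (∀ i : Fin (k + 1), IsQH k (β - (k - 1) + w k i) (Q i)) →
      ∑ i ∈ Finset.univ.filter (fun i : Fin (k + 1) => (i : ℕ) < k),
        ip k (β + w k i) (brkt k Q i) (P i) = 0) :
    P 0 = 0 ∧ P (zv k) = 0 ∧
      ∀ j : Fin (k + 1), 1 ≤ (j : ℕ) → (j : ℕ) < k - 1 →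
        ∀ Q' : MvPolynomial (Fin (k + 1)) ℝ, IsQH k (β - (k - 1) + w k j) Q' →
          ip k (β + w k j)
            (X (ev k) * pderiv 0 Q' - G k * pderiv (zv k) Q') (P j) = 0 := by
  have hz0 := zv_ne_zero hk
  have hzk : (zv k : ℕ) < k := by simp only [zv]; omega
  have h0k : ((0 : Fin (k + 1)) : ℕ) < k := by simp only [Fin.val_zero]; omega
  have hw0 : w k 0 = k := by simp [w]; omega
  have hwz : w k (zv k) = 1 := by rw [w, if_pos hzk]; simp only [zv]; omega
  have hwe : w k (ev k) = 2 * k - 1 := by simp [w, ev]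
  have hpairing (a : Fin (k + 1)) (q : MvPolynomial (Fin (k + 1)) ℝ)
      (hq : IsQH k (β - (k - 1) + w k a) q) (i : Fin (k + 1)) (hi : (i : ℕ) < k)
      (hother : ∀ l : Fin (k + 1), (l : ℕ) < k → l ≠ i →
        ip k (β + w k l) (brkt k (Pi.single a q) l) (P l) = 0) :
      ip k (β + w k i) (brkt k (Pi.single a q) i) (P i) = 0 := by
    have h := horth (Pi.single a q) (isQH_single (d := fun i => β - (k - 1) + w k i) hq)
    rwa [Finset.sum_eq_single i (fun l hl => hother l (Finset.mem_filter.1 hl).2)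
      (by simp [hi])] at h
  have hP0 : P 0 = 0 := by
    have hq : IsQH k (β - (k - 1) + w k (ev k)) (P 0) := by
      have h := hP 0 h0k
      rwa [show β + w k 0 = β - (k - 1) + w k (ev k) by omega] at h
    have hne (l : Fin (k + 1)) (hl : (l : ℕ) < k) : l ≠ ev k := by
      simp only [ev, ne_eq, Fin.ext_iff]
      omega
    have h := hpairing (ev k) (P 0) hq 0 h0k fun l hl hl0 => by
      rw [brkt_single_of_ne (hne l hl)]
      obtain rfl | hlz := eq_or_ne l (zv k)
      · simp [Fv_zv hk, pderiv_ev_G hk, ip_zero_left]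
      · simp [Fv_of_ne hl0 hlz, ip_zero_left]
    rw [brkt_single_of_ne (hne 0 h0k), Fv_zero, pderiv_X_self, mul_one,
      ip_neg_left, neg_eq_zero] at h
    exact eq_zero_of_ip_self_eq_zero _ _ _ h
  have hPz : P (zv k) = 0 := by
    have hq : IsQH k (β - (k - 1) + w k 0) (P (zv k)) := by
      have h := hP (zv k) hzk
      rwa [show β + w k (zv k) = β - (k - 1) + w k 0 by omega] at h
    have h := hpairing 0 (P (zv k)) hq (zv k) hzk fun l hl hlz => by
      obtain rfl | hl0 := eq_or_ne l 0
      · rw [hP0, ip_zero_right]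
      · simp [brkt_single_of_ne hl0, Fv_of_ne hl0 hlz, ip_zero_left]
    rw [brkt_single_of_ne hz0, Fv_zv hk, map_neg, pderiv_zero_G hk, mul_neg, neg_neg,
      mul_one] at h
    exact eq_zero_of_ip_self_eq_zero _ _ _ h
  refine ⟨hP0, hPz, fun j hj1 hjk Q' hQ' => ?_⟩
  have hj0 : j ≠ 0 := by
    rintro rfl
    simp at hj1
  have hjz : j ≠ zv k := by
    rintro rfl
    simp [zv] at hjk
  have h := hpairing j Q' hQ' j (by omega) fun l hl hlj => by
    obtain rfl | hl0 := eq_or_ne l 0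
    · rw [hP0, ip_zero_right]
    obtain rfl | hlz := eq_or_ne l (zv k)
    · rw [hPz, ip_zero_right]
    · simp [brkt_single_of_ne hlj, Fv_of_ne hl0 hlz, ip_zero_left]
  rwa [brkt_single_self, Fv_of_ne hj0 hjz, map_zero, mul_zero, sub_zero,
    sum_Fv_mul_pderiv hk] at h
end
end

section
/- Fix an integer k ≥ 2 and let δ ∈ ℕ. Let P̄ ∈ 𝒫_δ be an r-quasihomogeneous polynomial of quasidegree δ. If ⟨ε ∂Q/∂x₁ − G_k ∂Q/∂z, ε·P̄⟩_{r,δ+2k−1} = 0 for every Q ∈ 𝒫_{δ+k}, then P̄ = 0. -/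
open MvPolynomial

noncomputable section

theorem degreeOf_ev_G (k : ℕ) (hk : 2 ≤ k) : degreeOf (ev k) (G k) = 0 := by
  have hX : ∀ i : Fin (k + 1), (i : ℕ) < k → ∀ n,
      degreeOf (ev k) ((X i : MvPolynomial (Fin (k + 1)) ℝ) ^ n) = 0 := by
    intro i hi n
    have hne : ev k ≠ i := by
      rintro rfl
      simp [ev] at hi
    have := degreeOf_pow_le (R := ℝ) (ev k) (X i) n
    rw [degreeOf_X_of_ne hne] at this
    omega
  have hz : ((zv k : Fin (k + 1)) : ℕ) < k := by simp only [zv]; omega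
  refine Nat.le_zero.mp ((degreeOf_add_le _ _ _).trans (max_le (hX _ hz k).le ?_))
  refine (degreeOf_sum_le _ _ _).trans (Finset.sup_le fun i _ => ?_)
  split_ifs with hi
  · refine (degreeOf_mul_le _ _ _).trans ?_
    have h1 := hX i (by omega) 1
    rw [pow_one] at h1
    rw [h1, hX _ hz]
  · simp

/-- Every monomial of `G_k ∂/∂z (x^t)` has the same exponent of `ε` as `x^t`. -/
theorem apply_ev_of_coeff_G_mul_pderiv_ne_zero (k : ℕ) (hk : 2 ≤ k)
    {t u : Fin (k + 1) →₀ ℕ}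
    (hu : coeff u (G k * pderiv (zv k) (monomial t (1 : ℝ))) ≠ 0) : u (ev k) = t (ev k) := by
  rw [pderiv_monomial, coeff_mul_monomial'] at hu
  split_ifs at hu with hle
  · have hG : u - (t - Finsupp.single (zv k) 1) ∈ (G k).support :=
      mem_support_iff.mpr (left_ne_zero_of_mul hu)
    have h0 := degreeOf_le_iff.mp (degreeOf_ev_G k hk).le _ hG
    have hle' := hle (ev k)
    have hne : zv k ≠ ev k := by
      simp only [zv, ev, ne_eq, Fin.mk.injEq]
      omega
    simp only [Finsupp.tsub_apply, Finsupp.single_eq_of_ne' hne] at h0 hle'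
    omega
  · exact absurd rfl hu

/-- if `P̄ ∈ 𝒫_δ` and `⟨ε ∂Q/∂x₁ − G_k ∂Q/∂z, ε·P̄⟩_{r,δ+2k-1} = 0` for every
`Q ∈ 𝒫_{δ+k}`, then `P̄ = 0`. -/
theorem orthogonal_to_FQ_implies_zero (k : ℕ) (hk : 2 ≤ k) (δ : ℕ)
    (Pb : MvPolynomial (Fin (k + 1)) ℝ) (hPb : IsQH k δ Pb)
    (h : ∀ Q : MvPolynomial (Fin (k + 1)) ℝ, IsQH k (δ + k) Q →
      ip k (δ + (2 * k - 1))
        (X (ev k) * pderiv 0 Q - G k * pderiv (zv k) Q) (X (ev k) * Pb) = 0) :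
    Pb = 0 := by
  by_contra hP
  obtain ⟨s, hs, hmin⟩ :=
    Finset.exists_min_image Pb.support (fun s => s (ev k)) (support_nonempty.mpr hP)
  set t : Fin (k + 1) →₀ ℕ := s + Finsupp.single 0 1 with ht
  have hne : (0 : Fin (k + 1)) ≠ ev k := by
    simp only [ev, ne_eq, Fin.ext_iff, Fin.val_zero]
    omega
  have htev : t (ev k) = s (ev k) := by
    simp [ht, Finsupp.single_eq_of_ne' hne]
  have hQ : IsQH k (δ + k) (monomial t (1 : ℝ)) := by
    intro u hu
    rw [Finset.mem_singleton.mp (support_monomial_subset hu)]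
    have hw : w k 0 = k := by
      simp [w, show 0 < k by omega]
    simp only [ht, Finsupp.add_apply, mul_add, Finset.sum_add_distrib, hPb s hs,
      Finsupp.single_apply, mul_ite, mul_one, mul_zero, Finset.sum_ite_eq, Finset.mem_univ,
      if_true, hw]
  have hX : X (ev k) * pderiv 0 (monomial t (1 : ℝ))
      = monomial (Finsupp.single (ev k) 1 + s) ((s 0 : ℝ) + 1) := by
    rw [pderiv_monomial, X, monomial_mul, ht, add_tsub_cancel_right]
    simp
  have hcP : coeff (Finsupp.single (ev k) 1 + s) (X (ev k) * Pb) = coeff s Pb := by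
    rw [coeff_X_mul]
  have hcG : coeff (Finsupp.single (ev k) 1 + s)
      (G k * pderiv (zv k) (monomial t (1 : ℝ))) = 0 := by
    by_contra hc
    have := apply_ev_of_coeff_G_mul_pderiv_ne_zero k hk hc
    simp [htev] at this
  have hsne : coeff s Pb ≠ 0 := mem_support_iff.mp hs
  have hip := h _ hQ
  rw [ip, Finset.sum_eq_single (Finsupp.single (ev k) 1 + s), coeff_sub, hX, hcP, hcG,
    coeff_monomial, if_pos rfl, sub_zero] at hip
  · have h1 : (s 0 : ℝ) + 1 ≠ 0 := by positivity
    refine mul_ne_zero (mul_ne_zero h1 hsne) (ne_of_gt ?_) hip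
    exact div_pos (Finset.prod_pos fun i _ => by positivity) (by positivity)
  · intro u _ hu
    by_contra hc
    have hF := left_ne_zero_of_mul (left_ne_zero_of_mul hc)
    have hE := right_ne_zero_of_mul (left_ne_zero_of_mul hc)
    rw [coeff_sub, hX, coeff_monomial, if_neg hu.symm, zero_sub] at hF
    have hue := apply_ev_of_coeff_G_mul_pderiv_ne_zero k hk (neg_ne_zero.mp hF)
    rw [coeff_X_mul'] at hE
    split_ifs at hE with hmem
    · have := hmin _ (mem_support_iff.mpr hE)
      have hpos := Finsupp.mem_support_iff.mp hmem
      simp only [Finsupp.tsub_apply, Finsupp.single_eq_same] at this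
      omega
    · exact hE rfl
  · intro hn
    exact absurd (Finset.mem_union_right _ (mem_support_iff.mpr (hcP ▸ hsne))) hn
end
end

section
/- Fix an integer k ≥ 2 and let δ ∈ ℕ. Let P̄ ∈ 𝒫_δ be an r-quasihomogeneous polynomial of quasidegree δ. If ⟨ε ∂(x^q)/∂x₁ − G_k ∂(x^q)/∂z, ε·P̄⟩_{r,δ+2k−1} = 0 for every monomial x^q ∈ 𝒫_{δ+k} whose ε-exponent q_{k+1} equals 0, then every coefficient of P̄ on a monomial with ε-exponent 0 vanishes; equivalently, P̄ vanishes upon substituting ε = 0. -/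
open MvPolynomial

noncomputable section

theorem coeff_eq_zero_of_mem_supported_compl {σ R : Type*} [CommSemiring R] {i : σ}
    {p : MvPolynomial σ R} (hp : p ∈ supported R {i}ᶜ) {t : σ →₀ ℕ} (ht : t i ≠ 0) :
    p.coeff t = 0 := by
  by_contra hc
  have hi : i ∈ p.vars :=
    mem_vars_iff_mem_support i |>.2 ⟨t, mem_support_iff.2 hc, Finsupp.mem_support_iff.2 ht⟩
  exact mem_supported.1 hp hi rfl

theorem monomial_mem_supported_compl {σ R : Type*} [CommSemiring R] {i : σ} {t : σ →₀ ℕ}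
    (ht : t i = 0) (c : R) : monomial t c ∈ supported R {i}ᶜ := by
  refine mem_supported.2 fun j hj hji => ?_
  obtain ⟨d, hd, hjd⟩ := (mem_vars_iff_mem_support j).1 hj
  obtain rfl : d = t := by simpa using support_monomial_subset hd
  obtain rfl : j = i := hji
  exact Finsupp.mem_support_iff.1 hjd ht

theorem G_mem_supported_compl_ev {k : ℕ} (hk : k ≠ 0) : G k ∈ supported ℝ {ev k}ᶜ := by
  have hX : ∀ i : Fin (k + 1), (i : ℕ) < k → (X i : MvPolynomial _ ℝ) ∈ supported ℝ {ev k}ᶜ := by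
    intro i hi
    refine X_mem_supported.2 fun h => hi.ne ?_
    exact congrArg Fin.val h
  have hz := hX (zv k) (show k - 1 < k by omega)
  refine add_mem (pow_mem hz _) (sum_mem fun i _ => ?_)
  split_ifs with hi
  · exact mul_mem (hX i (by omega)) (pow_mem hz _)
  · exact zero_mem _

/-- The pairing with a polynomial divisible by `ε` only sees the monomials divisible by `ε`. -/
theorem ip_sub_X_ev_mul (k δ : ℕ) (s : Fin (k + 1) →₀ ℕ) (c : ℝ)
    {g : MvPolynomial (Fin (k + 1)) ℝ} (hg : g ∈ supported ℝ {ev k}ᶜ)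
    (P : MvPolynomial (Fin (k + 1)) ℝ) :
    ip k δ (X (ev k) * monomial s c - g) (X (ev k) * P) =
      c * P.coeff s *
        ((∏ i, (((Finsupp.single (ev k) 1 + s : Fin (k + 1) →₀ ℕ) i).factorial : ℝ) ^ w k i) / δ.factorial) := by
  have hcoeff : (X (ev k) * monomial s c - g).coeff (Finsupp.single (ev k) 1 + s) = c := by
    rw [coeff_sub, coeff_X_mul, coeff_monomial, if_pos rfl,
      coeff_eq_zero_of_mem_supported_compl hg (by simp), sub_zero]
  rw [ip, Finset.sum_eq_single (Finsupp.single (ev k) 1 + s), hcoeff, coeff_X_mul]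
  · intro t _ hts
    by_cases ht : t (ev k) = 0
    · rw [coeff_X_mul' t, if_neg (by simpa using ht), mul_zero, zero_mul]
    · rw [coeff_sub, coeff_eq_zero_of_mem_supported_compl hg ht, X, monomial_mul, coeff_monomial,
        if_neg hts.symm, sub_zero, zero_mul, zero_mul]
  · intro ht
    rw [Finset.mem_union, not_or, notMem_support_iff, notMem_support_iff] at ht
    rw [ht.1, zero_mul, zero_mul]

/-- if `P̄ ∈ 𝒫_δ` and `⟨ε ∂(x^q)/∂x₁ − G_k ∂(x^q)/∂z, ε·P̄⟩_{r,δ+2k-1} = 0` for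
every monomial `x^q ∈ 𝒫_{δ+k}` with `ε`-exponent `q_{k+1} = 0`, then every coefficient of `P̄`
on a monomial with `ε`-exponent `0` vanishes. -/
theorem coeffs_eps_zero_vanish (k : ℕ) (hk : 2 ≤ k) (δ : ℕ)
    (Pb : MvPolynomial (Fin (k + 1)) ℝ) (hPb : IsQH k δ Pb)
    (h : ∀ q : Fin (k + 1) →₀ ℕ, (∑ i, w k i * q i = δ + k) → q (ev k) = 0 →
      ip k (δ + (2 * k - 1))
        (X (ev k) * pderiv 0 (monomial q (1 : ℝ))
          - G k * pderiv (zv k) (monomial q (1 : ℝ)))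
        (X (ev k) * Pb) = 0) :
    ∀ s : Fin (k + 1) →₀ ℕ, s (ev k) = 0 → Pb.coeff s = 0 := by
  intro s hs
  by_contra hc
  have h0 : (0 : Fin (k + 1)) ≠ ev k := fun h0 => by
    have := congrArg Fin.val h0
    simp only [ev, Fin.val_zero] at this
    omega
  have hw : w k 0 = k := by simp [w, show 0 < k by omega]
  have hq : (s + Finsupp.single 0 1 : Fin (k + 1) →₀ ℕ) (ev k) = 0 := by
    simp [hs, Finsupp.single_eq_of_ne h0.symm]
  have hdeg : ∑ i, w k i * (s + Finsupp.single 0 1 : Fin (k + 1) →₀ ℕ) i = δ + k := by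
    simp only [Finsupp.add_apply, mul_add, Finset.sum_add_distrib,
      hPb s (mem_support_iff.2 hc)]
    rw [Finset.sum_eq_single 0 (fun i _ hi => by simp [Finsupp.single_eq_of_ne hi]) (by simp)]
    simp [hw]
  have key := h _ hdeg hq
  rw [pderiv_monomial, add_tsub_cancel_right, ip_sub_X_ev_mul] at key
  · refine mul_ne_zero (mul_ne_zero ?_ hc) ?_ key
    · simp only [Finsupp.add_apply, Finsupp.single_eq_same, one_mul]
      positivity
    · positivity
  · rw [pderiv_monomial]
    exact mul_mem (G_mem_supported_compl_ev (by omega))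
      (monomial_mem_supported_compl (by rw [Finsupp.tsub_apply, hq, Nat.zero_sub]) _)
end
end
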